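/- Let N be a nonnegative integer and η ∈ ℝ_N with η ≠ 0. Define Φ : ℂ × ℂ → ℂ by Φ(u,w) = ∫₀^{τ/i}∫₀^1 K(z,w)·K(u, conj(z))·M(z, conj(z)) dx dy, with z = x+iy; then Φ(u, conj(v)) = ⟨K_v, K_u⟩ for all u, v ∈ ℂ, and Φ satisfies the difference equation θ(u−w−Nη+1/2+τ/2)·Φ(u, w−η) = e^{2πiNη}·θ(u−w+Nη+1/2+τ/2)·Φ(u−η, w) for all u, w ∈ ℂ. -/

import Mathlib

noncomputable section
open Complex MeasureTheory

def cπ : ℂ := Real.pi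

/-- Jacobi's first theta function θ₁(x|τ). -/
def θf (τ x : ℂ) : ℂ :=
  I * ∑' n : ℤ, (-1 : ℂ) ^ n *
    Complex.exp (cπ * I * τ * ((n : ℂ) - 1/2)^2 + cπ * I * (2*(n : ℂ) - 1) * x)

/-- The space Θ_N of even theta functions of order 2N. -/
def ThetaSp (τ : ℂ) (N : ℕ) (f : ℂ → ℂ) : Prop :=
  Differentiable ℂ f ∧ (∀ x, f (x + 1) = f x) ∧
  (∀ x, f (x + τ) = Complex.exp (-2*cπ*I*N*(2*x + τ)) * f x) ∧
  (∀ x, f (-x) = f x)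

/-- Sklyanin's weight function M(u,v). -/
def Mw (τ η : ℂ) (N : ℕ) (u v : ℂ) : ℂ :=
  θf τ (2*u) * θf τ (2*v) /
    (Complex.exp (2*cπ*I*u*(N+2)) *
      ∏ k ∈ Finset.range (N+2),
        (θf τ (u + v + (2*(k:ℂ) - N - 1)*η + 1/2 + τ/2) *
         θf τ (u - v + (2*(k:ℂ) - N - 1)*η + 1/2 + τ/2)))

/-- Sklyanin's invariant pairing, with τ = t * I. -/
def pairing (τ η : ℂ) (t : ℝ) (N : ℕ) (f g : ℂ → ℂ) : ℂ :=
  ∫ y in (0:ℝ)..t, ∫ x in (0:ℝ)..(1:ℝ),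
    f (x + y*I) * (starRingEnd ℂ) (g (x + y*I)) *
      Mw τ η N (x + y*I) ((starRingEnd ℂ) (x + y*I))

/-- The numerator defining the difference operator Δ(a). -/
def ΔRHS (τ η : ℂ) (N : ℕ) (a₁ a₂ a₃ a₄ : ℂ) (f : ℂ → ℂ) (x : ℂ) : ℂ :=
  θf τ (x + a₁ - N*η/2) * θf τ (x + a₂ - N*η/2) * θf τ (x + a₃ - N*η/2) *
    θf τ (x + a₄ - N*η/2) * f (x + η)
  - θf τ (x - a₁ + N*η/2) * θf τ (x - a₂ + N*η/2) * θf τ (x - a₃ + N*η/2) *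
    θf τ (x - a₄ + N*η/2) * f (x - η)

/-- The involution σ on Θ_N. -/
def σop (τ : ℂ) (N : ℕ) (f : ℂ → ℂ) (x : ℂ) : ℂ :=
  Complex.exp (2*cπ*I*N*(1/4 + τ/4 + x)) * f (x + 1/2 + τ/2)

/-- q-Pochhammer infinite product (a;p)_∞. -/
def qPoch (a p : ℂ) : ℂ := ∏' j : ℕ, (1 - a * p^j)

/-- The constant C of Theorem 3.2. -/
def Cconst (τ η : ℂ) (N : ℕ) : ℂ :=
  2*η * Complex.exp (2*cπ*I*τ*(3/8)) /
    (θf τ (2*(N+1)*η) *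
      (qPoch (Complex.exp (2*cπ*I*τ)) (Complex.exp (2*cπ*I*τ)))^3)

/-- The kernel K(u,w). -/
def Kk (τ η : ℂ) (N : ℕ) (u w : ℂ) : ℂ :=
  Complex.exp (2*cπ*I*u*(N:ℂ)) *
  ∏ k ∈ Finset.range N,
    (θf τ (u + w + (2*(k:ℂ) - N + 1)*η + 1/2 + τ/2) *
     θf τ (u - w + (2*(k:ℂ) - N + 1)*η + 1/2 + τ/2))

/-- The basis functions e_k^N(x;a,b). -/
def ekN (τ η : ℂ) (N k : ℕ) (a b : ℂ) (x : ℂ) : ℂ :=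
  (∏ j ∈ Finset.range k, (θf τ (a + x + 2*(j:ℂ)*η) * θf τ (a - x + 2*(j:ℂ)*η))) *
  (∏ j ∈ Finset.range (N - k), (θf τ (b + x + 2*(j:ℂ)*η) * θf τ (b - x + 2*(j:ℂ)*η)))

/-- Elliptic number [x] = θ(2ηx). -/
def ell (τ η x : ℂ) : ℂ := θf τ (2*η*x)

/-- Elliptic shifted factorial [x]_k. -/
def ellFac (τ η x : ℂ) (k : ℕ) : ℂ := ∏ j ∈ Finset.range k, ell τ η (x + j)


/-- The kernel Φ(u,w) = ∬ K(z,w)K(u,conj z)M(z,conj z) dx dy, with τ = t·i. -/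
def Φfun (τ η : ℂ) (t : ℝ) (N : ℕ) (u w : ℂ) : ℂ :=
  ∫ y in (0:ℝ)..t, ∫ x in (0:ℝ)..(1:ℝ),
    Kk τ η N ((x:ℂ) + (y:ℂ)*I) w *
      Kk τ η N u ((starRingEnd ℂ) ((x:ℂ) + (y:ℂ)*I)) *
      Mw τ η N ((x:ℂ) + (y:ℂ)*I) ((starRingEnd ℂ) ((x:ℂ) + (y:ℂ)*I))


/-- Riemann's theta function in the first variable. -/
def vt (τ z : ℂ) : ℂ := jacobiTheta₂ z τ
def dA (τ x : ℂ) : ℂ := jacobiTheta₂ (2*x) (2*τ)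
def dB (τ x : ℂ) : ℂ := Complex.exp (cπ*I*(τ/2 + 2*x)) * jacobiTheta₂ (2*x+τ) (2*τ)

lemma vt_dup {τ : ℂ} (hτ : 0 < τ.im) (x y : ℂ) :
    vt τ (x+y) * vt τ (x-y) = dA τ x * dA τ y + dB τ x * dB τ y := by
  have hτ2 : 0 < (2*τ).im := by simpa using hτ
  have s1 (z : ℂ) := ((summable_jacobiTheta₂_term_iff z τ).mpr hτ)
  have s2 (z : ℂ) := ((summable_jacobiTheta₂_term_iff z (2*τ)).mpr hτ2)
  have e0 : HasSum (fun p : ℤ × ℤ => jacobiTheta₂_term p.1 (x+y) τ * jacobiTheta₂_term p.2 (x-y) τ)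
      (vt τ (x+y) * vt τ (x-y)) := by
    have h := summable_mul_of_summable_norm (s1 (x+y)).norm (s1 (x-y)).norm
    have h2 := tsum_mul_tsum_of_summable_norm (s1 (x+y)).norm (s1 (x-y)).norm
    unfold vt jacobiTheta₂
    rw [h2]; exact h.hasSum
  have e1 : HasSum (fun p : ℤ × ℤ => jacobiTheta₂_term p.1 (2*x) (2*τ) * jacobiTheta₂_term p.2 (2*y) (2*τ))
      (dA τ x * dA τ y) := by
    have h := summable_mul_of_summable_norm (s2 (2*x)).norm (s2 (2*y)).norm
    have h2 := tsum_mul_tsum_of_summable_norm (s2 (2*x)).norm (s2 (2*y)).norm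
    unfold dA jacobiTheta₂
    rw [h2]; exact h.hasSum
  have e2 : HasSum (fun p : ℤ × ℤ =>
      Complex.exp (cπ*I*(τ/2 + 2*x)) * Complex.exp (cπ*I*(τ/2 + 2*y)) * 
      (jacobiTheta₂_term p.1 (2*x+τ) (2*τ) * jacobiTheta₂_term p.2 (2*y+τ) (2*τ)))
      (dB τ x * dB τ y) := by
    have h := summable_mul_of_summable_norm (s2 (2*x+τ)).norm (s2 (2*y+τ)).norm
    have h2 := tsum_mul_tsum_of_summable_norm (s2 (2*x+τ)).norm (s2 (2*y+τ)).norm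
    have : dB τ x * dB τ y = Complex.exp (cπ*I*(τ/2 + 2*x)) * Complex.exp (cπ*I*(τ/2 + 2*y)) * 
      (jacobiTheta₂ (2*x+τ) (2*τ) * jacobiTheta₂ (2*y+τ) (2*τ)) := by
      unfold dB; ring
    rw [this]
    apply HasSum.mul_left
    unfold jacobiTheta₂
    rw [h2]; exact h.hasSum
  let i : ℤ × ℤ → ℤ × ℤ := fun p => (p.1 + p.2, p.1 - p.2)
  let j : ℤ × ℤ → ℤ × ℤ := fun p => (p.1 + p.2 + 1, p.1 - p.2)
  have hi : Function.Injective i := by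
    rintro ⟨a, b⟩ ⟨c, d⟩ h
    simp only [i, Prod.mk.injEq] at h ⊢
    omega
  have hj : Function.Injective j := by
    rintro ⟨a, b⟩ ⟨c, d⟩ h
    simp only [j, Prod.mk.injEq] at h ⊢
    omega
  have hc : IsCompl (Set.range i) (Set.range j) := by
    constructor
    · rw [Set.disjoint_left]
      rintro _ ⟨⟨a, b⟩, rfl⟩ ⟨⟨c, d⟩, h⟩
      simp only [i, j, Prod.mk.injEq] at h
      omega
    · rw [codisjoint_iff_le_sup]
      rintro ⟨a, b⟩ -
      rcases Int.even_or_odd' (a + b) with ⟨k, hk | hk⟩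
      · left
        exact ⟨(k, k - b), by simp only [i, Prod.mk.injEq]; omega⟩
      · right
        exact ⟨(k, k - b), by simp only [j, Prod.mk.injEq]; omega⟩
  refine e0.unique (HasSum.add_isCompl hc ?_ ?_)
  · refine (Function.Injective.hasSum_range_iff (f := (fun p : ℤ × ℤ => jacobiTheta₂_term p.1 (x+y) τ * jacobiTheta₂_term p.2 (x-y) τ)) hi).mpr ?_
    convert e1 using 2 with p
    simp only [Function.comp_apply, i, jacobiTheta₂_term, ← Complex.exp_add]
    congr 1; push_cast; ring
  · refine (Function.Injective.hasSum_range_iff (f := (fun p : ℤ × ℤ => jacobiTheta₂_term p.1 (x+y) τ * jacobiTheta₂_term p.2 (x-y) τ)) hj).mpr ?_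
    convert e2 using 2 with p
    simp only [Function.comp_apply, j, jacobiTheta₂_term, ← Complex.exp_add, cπ]
    congr 1; push_cast; ring

lemma vt_neg (τ x : ℂ) : vt τ (-x) = vt τ x := jacobiTheta₂_neg_left _ _
lemma vt_add_one (τ x : ℂ) : vt τ (x+1) = vt τ x := jacobiTheta₂_add_left _ _
lemma vt_add_tau (τ x : ℂ) : vt τ (x+τ) = Complex.exp (-cπ*I*(τ+2*x)) * vt τ x :=
  jacobiTheta₂_add_left' _ _
lemma vt_differentiable {τ : ℂ} (hτ : 0 < τ.im) : Differentiable ℂ (vt τ) :=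
  fun z => differentiableAt_jacobiTheta₂_fst z hτ

lemma cexp_pi : Complex.exp (cπ * I) = -1 := by
  unfold cπ; exact Complex.exp_pi_mul_I

lemma θf_eq (τ x : ℂ) :
    θf τ x = I * Complex.exp (cπ*I*(τ/4 - x)) * vt τ (x + 1/2 - τ/2) := by
  unfold θf vt jacobiTheta₂
  rw [mul_assoc I (cexp (cπ*I*(τ/4 - x)))]
  congr 1
  rw [← tsum_mul_left]
  apply tsum_congr
  intro n
  rw [← cexp_pi, ← Complex.exp_int_mul, jacobiTheta₂_term, ← Complex.exp_add, ← Complex.exp_add]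
  congr 1
  unfold cπ
  ring

lemma θf_hat (τ x : ℂ) :
    θf τ (x + 1/2 + τ/2) = Complex.exp (-cπ*I*(τ/4 + x)) * vt τ x := by
  rw [θf_eq, show x + 1/2 + τ/2 + 1/2 - τ/2 = x + 1 by ring, vt_add_one]
  congr 1
  have : cexp (cπ * I * (τ / 4 - (x + 1 / 2 + τ / 2))) =
      Complex.exp (-cπ*I*(τ/4 + x)) * Complex.exp (-(Real.pi / 2 * I)) := by
    rw [← Complex.exp_add]; congr 1; unfold cπ; ring
  rw [this, Complex.exp_neg (_ * I), Complex.exp_pi_div_two_mul_I]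
  simp only [inv_I]
  linear_combination (-cexp (-cπ * I * (τ / 4 + x))) * I_mul_I

lemma θf_dup {τ : ℂ} (hτ : 0 < τ.im) (x y : ℂ) :
    θf τ (x+y) * θf τ (x-y) = dA τ x * dB τ y - dB τ x * dA τ y := by
  have h := vt_dup hτ (x + 1/2 - τ/2) y
  have hj : jacobiTheta₂ (2*x+τ) (2*τ) =
      Complex.exp (-cπ*I*(4*x)) * jacobiTheta₂ (2*x-τ) (2*τ) := by
    have := jacobiTheta₂_add_left' (2*x-τ) (2*τ)
    rw [show 2*x-τ+2*τ = 2*x+τ by ring] at this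
    rw [this]; congr 2; unfold cπ; ring
  have hA : dA τ (x + 1/2 - τ/2) = Complex.exp (cπ*I*(2*x - τ/2)) * dB τ x := by
    unfold dA dB
    rw [show 2*(x+1/2-τ/2) = 2*x-τ+1 by ring, jacobiTheta₂_add_left, hj, ← mul_assoc, ← mul_assoc,
      ← Complex.exp_add, ← Complex.exp_add]
    ring_nf; simp
  have hB : dB τ (x + 1/2 - τ/2) = -Complex.exp (cπ*I*(2*x - τ/2)) * dA τ x := by
    unfold dA dB
    rw [show 2*(x+1/2-τ/2)+τ = 2*x+1 by ring, jacobiTheta₂_add_left]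
    congr 1
    rw [← neg_one_mul, ← cexp_pi, ← Complex.exp_add]
    congr 1; ring
  have he : Complex.exp (cπ*I*(τ/4-(x+y))) * Complex.exp (cπ*I*(τ/4-(x-y))) *
      Complex.exp (cπ*I*(2*x - τ/2)) = 1 := by
    rw [← Complex.exp_add, ← Complex.exp_add, ← Complex.exp_zero]; congr 1; ring
  rw [θf_eq, θf_eq, show x+y+1/2-τ/2 = x+1/2-τ/2+y by ring, show x-y+1/2-τ/2 = x+1/2-τ/2-y by ring]
  rw [hA, hB] at h
  linear_combination (I * I * Complex.exp (cπ*I*(τ/4-(x+y))) * Complex.exp (cπ*I*(τ/4-(x-y)))) * h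
    + (dB τ x * dA τ y - dA τ x * dB τ y) * (I * I * he + I_mul_I)

lemma θf_add_tau (τ x : ℂ) : θf τ (x+τ) = -Complex.exp (-cπ*I*(τ+2*x)) * θf τ x := by
  rw [θf_eq, θf_eq, show x+τ+1/2-τ/2 = x+1/2-τ/2+τ by ring, vt_add_tau, ← neg_one_mul (cexp _),
    ← cexp_pi]
  have : Complex.exp (cπ*I*(τ/4-(x+τ))) * Complex.exp (-cπ*I*(τ+2*(x+1/2-τ/2))) =
    Complex.exp (cπ*I) * Complex.exp (-cπ*I*(τ+2*x)) * Complex.exp (cπ*I*(τ/4-x)) := by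
    rw [← Complex.exp_add, ← Complex.exp_add, ← Complex.exp_add, Complex.exp_eq_exp_iff_exists_int]
    refine ⟨-1, ?_⟩
    unfold cπ; push_cast; ring
  linear_combination (I * vt τ (x+1/2-τ/2)) * this

lemma θf_add_one (τ x : ℂ) : θf τ (x+1) = -θf τ x := by
  rw [θf_eq, θf_eq, show x+1+1/2-τ/2 = x+1/2-τ/2+1 by ring, vt_add_one]
  have : Complex.exp (cπ*I*(τ/4-(x+1))) = Complex.exp (cπ*I) * Complex.exp (cπ*I*(τ/4-x)) := by
    rw [← Complex.exp_add, Complex.exp_eq_exp_iff_exists_int]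
    refine ⟨-1, ?_⟩
    unfold cπ; push_cast; ring
  rw [this, cexp_pi]; ring

lemma θf_neg (τ x : ℂ) : θf τ (-x) = -θf τ x := by
  rw [θf_eq, θf_eq, ← vt_neg, show -(-x+1/2-τ/2) = x+1/2-τ/2+τ-1 by ring,
    ← vt_add_one τ (x+1/2-τ/2+τ-1), sub_add_cancel, vt_add_tau]
  have : Complex.exp (cπ*I*(τ/4-(-x))) * Complex.exp (-cπ*I*(τ+2*(x+1/2-τ/2))) =
    Complex.exp (cπ*I) * Complex.exp (cπ*I*(τ/4-x)) := by
    rw [← Complex.exp_add, ← Complex.exp_add, Complex.exp_eq_exp_iff_exists_int]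
    refine ⟨-1, ?_⟩
    unfold cπ; push_cast; ring
  rw [cexp_pi] at this
  linear_combination (I * vt τ (x+1/2-τ/2)) * this

lemma θf_differentiable {τ : ℂ} (hτ : 0 < τ.im) : Differentiable ℂ (θf τ) := by
  have : θf τ = fun x => I * Complex.exp (cπ*I*(τ/4 - x)) * vt τ (x + 1/2 - τ/2) :=
    funext (θf_eq τ)
  rw [this]
  have := vt_differentiable hτ
  fun_prop

/-- The fundamental four-term theta identity. -/
lemma four_term {τ : ℂ} (hτ : 0 < τ.im) (z a b c d : ℂ) (h : a + b + c + d = 0) :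
    vt τ (z+a) * vt τ (z+b) * θf τ (z+c) * θf τ (z+d)
      - vt τ (z-a) * vt τ (z-b) * θf τ (z-c) * θf τ (z-d)
    = θf τ (2*z) * θf τ (c+d) * vt τ (a+c) * vt τ (a+d) := by
  have h1 := vt_dup hτ (z+(a+b)/2) ((a-b)/2)
  have h2 := θf_dup hτ (z-(a+b)/2) ((c-d)/2)
  have h3 := vt_dup hτ (z-(a+b)/2) ((a-b)/2)
  have h4 := θf_dup hτ (z+(a+b)/2) ((c-d)/2)
  have h5 := θf_dup hτ (z+(a+b)/2) (z-(a+b)/2)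
  have h6 := vt_dup hτ ((a-b)/2) ((c-d)/2)
  rw [show z+(a+b)/2+(a-b)/2 = z+a by ring, show z+(a+b)/2-(a-b)/2 = z+b by ring] at h1
  rw [show z-(a+b)/2+(c-d)/2 = z+c by linear_combination (-1/2)*h,
    show z-(a+b)/2-(c-d)/2 = z+d by linear_combination (-1/2)*h] at h2
  rw [show z-(a+b)/2+(a-b)/2 = z-b by ring, show z-(a+b)/2-(a-b)/2 = z-a by ring] at h3
  rw [show z+(a+b)/2+(c-d)/2 = z-d by linear_combination (1/2)*h,
    show z+(a+b)/2-(c-d)/2 = z-c by linear_combination (1/2)*h] at h4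
  rw [show z+(a+b)/2+(z-(a+b)/2) = 2*z by ring,
    show z+(a+b)/2-(z-(a+b)/2) = -(c+d) by linear_combination h, θf_neg] at h5
  rw [show (a-b)/2+(c-d)/2 = a+c by linear_combination (-1/2)*h,
    show (a-b)/2-(c-d)/2 = a+d by linear_combination (-1/2)*h] at h6
  calc _ = (vt τ (z+a) * vt τ (z+b)) * (θf τ (z+c) * θf τ (z+d))
      - (vt τ (z-b) * vt τ (z-a)) * (θf τ (z-d) * θf τ (z-c)) := by ring
    _ = -(θf τ (2*z) * -θf τ (c+d)) * (vt τ (a+c) * vt τ (a+d)) := by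
      rw [h1, h2, h3, h4, h5, h6]; ring
    _ = _ := by ring


lemma im_tI {t : ℝ} (ht : 0 < t) : 0 < ((t:ℂ) * I).im := by simpa using ht

lemma vt_imag_ne {t : ℝ} (ht : 0 < t) (y : ℝ) : vt (t*I) (y*I) ≠ 0 := by
  have hs := (summable_jacobiTheta₂_term_iff (y*I) (t*I)).mpr (im_tI ht)
  have he : ∀ n : ℤ, jacobiTheta₂_term n (y*I) (t*I) =
      ((Real.exp (-2*Real.pi*n*y - Real.pi*n^2*t) : ℝ) : ℂ) := by
    intro n
    rw [jacobiTheta₂_term, Complex.ofReal_exp]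
    congr 1
    push_cast
    linear_combination (2*Real.pi*n*y + Real.pi*n^2*t : ℂ) * I_mul_I
  unfold vt jacobiTheta₂
  simp_rw [he] at hs ⊢
  rw [← Complex.ofReal_tsum]
  have hs' := Complex.summable_ofReal.mp hs
  have := hs'.tsum_pos (fun n => (Real.exp_pos _).le) 0 (Real.exp_pos _)
  exact_mod_cast this.ne'

lemma vt_real_ne {t : ℝ} (ht : 0 < t) (x : ℝ) : vt (t*I) x ≠ 0 := by
  have htc : (t:ℂ) ≠ 0 := by exact_mod_cast ht.ne'
  unfold vt
  rw [jacobiTheta₂_functional_equation]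
  have h1 : (x:ℂ) / (t*I) = ((-(x/t) : ℝ) : ℂ) * I := by
    push_cast; field_simp; rw [I_sq]; ring
  have h2 : (-1:ℂ) / (t*I) = ((1/t : ℝ) : ℂ) * I := by
    push_cast; field_simp; rw [I_sq]
  have h3 : -I * (t*I) = (t:ℂ) := by linear_combination (-t:ℂ) * I_mul_I
  rw [h1, h2, h3]
  have := vt_imag_ne (t := 1/t) (by positivity) (-(x/t))
  unfold vt at this
  refine mul_ne_zero (mul_ne_zero ?_ (Complex.exp_ne_zero _)) this
  rw [one_div]
  refine inv_ne_zero ?_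
  rw [Ne, Complex.cpow_eq_zero_iff]
  tauto

lemma vt_double {τ : ℂ} (hτ : 0 < τ.im) (z : ℂ) :
    vt τ z * vt τ (z+1/2) = vt (2*τ) (2*z+1/2) * vt (2*τ) (1/2) := by
  have h := vt_dup hτ (z+1/4) (-1/4)
  have hB : dB τ (-1/4) = 0 := by
    unfold dB
    have h1 := vt_add_tau (2*τ) (1/2-τ)
    have h2 := vt_neg (2*τ) (τ-1/2)
    have h3 := vt_add_one (2*τ) (τ-1/2)
    rw [show 1/2-τ+2*τ = τ-1/2+1 by ring, h3, show -cπ*I*(2*τ+2*(1/2-τ)) = -(cπ*I) by ring,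
      Complex.exp_neg, cexp_pi] at h1
    rw [show -(τ-1/2) = 1/2-τ by ring] at h2
    unfold vt at h1 h2
    rw [show (2:ℂ)*(-1/4)+τ = τ-1/2 by ring]
    rw [h2] at h1
    have : jacobiTheta₂ (τ-1/2) (2*τ) = 0 := by linear_combination (1/2)*h1
    rw [this, mul_zero]
  have hA : dA τ (-1/4) = vt (2*τ) (1/2) := by
    unfold dA
    rw [← vt_neg]; unfold vt; congr 1; ring
  have hA2 : dA τ (z+1/4) = vt (2*τ) (2*z+1/2) := by
    unfold dA vt; congr 1; ring
  rw [hB, hA, hA2, show z+1/4+(-1/4) = z by ring, show z+1/4-(-1/4) = z+1/2 by ring] at h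
  rw [h]; ring

lemma vt_sub_tau (τ x : ℂ) : vt τ (x-τ) = Complex.exp (-cπ*I*(τ-2*x)) * vt τ x := by
  rw [← vt_neg, show -(x-τ) = -x+τ by ring, vt_add_tau, vt_neg]; congr 2; ring

lemma vt_int_tau (τ x : ℂ) (m : ℤ) : vt τ (x + m*τ) = 0 ↔ vt τ x = 0 := by
  induction m with
  | zero => simp
  | succ i ih =>
    rw [← ih, show x + ((i+1 : ℤ):ℂ)*τ = x + ((i:ℤ):ℂ)*τ + τ by push_cast; ring, vt_add_tau]
    simp [Complex.exp_ne_zero]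
  | pred i ih =>
    rw [← ih, show x + ((-i-1 : ℤ):ℂ)*τ = x + ((-i:ℤ):ℂ)*τ - τ by push_cast; ring, vt_sub_tau]
    simp [Complex.exp_ne_zero]

/-- Nonvanishing for large `t`, in a fundamental strip. -/
lemma vt_ne_base {t : ℝ} (ht : 1 ≤ t) (z : ℂ) (h0 : 0 ≤ z.im) (h1 : z.im ≤ t)
    (hz : |z.re| < 1/2) : vt (t*I) z ≠ 0 := by
  have ht0 : 0 < t := by linarith
  set q : ℝ := Real.exp (-(Real.pi*t)) with hq
  have hq0 : 0 < q := Real.exp_pos _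
  have hpi := Real.pi_gt_three
  have hq6 : q < 1/6 := by
    have h2 : 1 + Real.pi*t/2 ≤ Real.exp (Real.pi*t/2) := by
      have := Real.add_one_le_exp (Real.pi*t/2); linarith
    have h3 : Real.exp (Real.pi*t) = Real.exp (Real.pi*t/2) * Real.exp (Real.pi*t/2) := by
      rw [← Real.exp_add]; congr 1; ring
    have h4 : 3 ≤ Real.pi*t := by nlinarith
    have h5 : 6 < Real.exp (Real.pi*t) := by rw [h3]; nlinarith
    rw [hq, Real.exp_neg, ← one_div]
    exact one_div_lt_one_div_of_lt (by norm_num) h5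
  set Y : ℂ := Complex.exp (2*Real.pi*I*z) with hY
  have hY0 : Y ≠ 0 := Complex.exp_ne_zero _
  set a : ℝ := ‖Y‖ with ha
  have haE : a = Real.exp (-(2*Real.pi*z.im)) := by
    rw [ha, hY, Complex.norm_exp]; congr 1; simp
  have ha0 : 0 < a := by rw [haE]; exact Real.exp_pos _
  have ha1 : a ≤ 1 := by
    rw [haE]; apply Real.exp_le_one_iff.mpr; nlinarith
  have haq : q^2 ≤ a := by
    rw [haE, hq, ← Real.exp_nat_mul]; apply Real.exp_le_exp.mpr; push_cast; nlinarith
  let r : ℕ → ℂ := fun n => (q:ℂ)^(n^2) * (Y⁻¹)^n * ∑ j ∈ Finset.range (2*n+1), Y^j * (-q)^(2*n+1-1-j)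
  have hqc : (q:ℂ) = Complex.exp (Real.pi*I*(t*I)) := by
    rw [hq, Complex.ofReal_exp]; congr 1; push_cast; linear_combination (-Real.pi*t:ℂ)*I_mul_I
  have hYq : Y + q ≠ 0 := by
    intro h
    have h2 : Y = Complex.exp (Real.pi*I + Real.pi*I*(t*I)) := by
      rw [Complex.exp_add, Complex.exp_pi_mul_I, ← hqc]; linear_combination h
    rw [hY, Complex.exp_eq_exp_iff_exists_int] at h2
    obtain ⟨n, hn⟩ := h2
    have h3 : 2*z = 1 + t*I + 2*n := by
      have : (Real.pi:ℂ)*I ≠ 0 := by simp [Real.pi_ne_zero]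
      apply mul_left_cancel₀ this; linear_combination hn
    have h4 := congrArg Complex.re h3
    simp at h4
    rw [abs_lt] at hz
    have h5 : (-1:ℝ) < n := by linarith
    have h6 : (n:ℝ) < 0 := by linarith
    norm_cast at h5 h6
    have : (-1:ℤ) < n := by exact_mod_cast h5
    omega
  have hsum := (hasSum_jacobiTheta₂_term z (im_tI ht0)).nat_add_neg_add_one
  have hterm : ∀ n : ℕ, jacobiTheta₂_term n z (t*I) + jacobiTheta₂_term (-(n+1)) z (t*I) =
      Y⁻¹ * (Y+q) * r n := by
    intro n
    have e1 : ∀ m : ℤ, jacobiTheta₂_term m z (t*I) = Y^m * (q:ℂ)^(m^2) := by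
      intro m
      rw [jacobiTheta₂_term, hY, hqc, ← Complex.exp_int_mul, ← Complex.exp_int_mul,
        ← Complex.exp_add]
      congr 1; push_cast; ring
    have hg := geom_sum₂_mul Y (-(q:ℂ)) (2*n+1)
    have hqc0 : (q:ℂ) ≠ 0 := by exact_mod_cast hq0.ne'
    rw [e1, e1]
    have e2 : Y ^ (-((n:ℤ)+1)) = (Y⁻¹)^(n+1) := by
      rw [zpow_neg, inv_pow]; norm_cast
    have e3 : (q:ℂ)^((-((n:ℤ)+1))^2) = (q:ℂ)^(n^2) * (q:ℂ)^(2*n+1) := by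
      rw [← pow_add, ← zpow_natCast]; congr 1; push_cast; ring
    have e4 : (q:ℂ)^((n:ℤ)^2) = (q:ℂ)^(n^2) := by
      rw [← zpow_natCast]; congr 1
    have e5 : (-(q:ℂ))^(2*n+1) = -(q:ℂ)^(2*n+1) := Odd.neg_pow ⟨n, rfl⟩ _
    rw [e2, e3, e4, zpow_natCast]
    rw [e5] at hg
    have e6 : Y⁻¹^(n+1) * Y^(2*n+1) = Y^n := by
      rw [show 2*n+1 = n+1+n by ring, pow_add Y, inv_pow, inv_mul_cancel_left₀ (pow_ne_zero _ hY0)]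
    simp only [r]
    rw [← e6, pow_succ (Y⁻¹) n]
    linear_combination (-(Y⁻¹^n) * Y⁻¹ * (q:ℂ)^(n^2)) * hg
  have hr0 : r 0 = 1 := by simp [r]
  have hrb : ∀ n, ‖r n‖ ≤ (3*q)^n := by
    intro n
    have hb : ∀ j ∈ Finset.range (2*n+1), ‖Y^j * (-(q:ℂ))^(2*n+1-1-j)‖ ≤ a^n := by
      intro j hj
      rw [Finset.mem_range] at hj
      rw [norm_mul, norm_pow, norm_pow, norm_neg, Complex.norm_real, Real.norm_of_nonneg hq0.le, ← ha]
      have hq1 : q ≤ 1 := by linarith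
      rcases le_or_gt n j with h | h
      · calc a^j * q^(2*n+1-1-j) ≤ a^n * 1 := by
              gcongr ?_ * ?_
              · exact pow_le_pow_of_le_one ha0.le ha1 h
              · exact pow_le_one₀ hq0.le hq1
          _ = a^n := mul_one _
      · calc a^j * q^(2*n+1-1-j) ≤ a^j * (q^2)^(n-j) := by
              rw [← pow_mul]
              gcongr ?_ * ?_
              exact pow_le_pow_of_le_one hq0.le hq1 (by omega)
          _ ≤ a^j * a^(n-j) := by gcongr
          _ = a^n := by rw [← pow_add]; congr 1; omega
    have hs := norm_sum_le_of_le _ hb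
    rw [Finset.sum_const, Finset.card_range, nsmul_eq_mul] at hs
    simp only [r]
    rw [norm_mul, norm_mul, norm_pow, norm_pow, norm_inv, Complex.norm_real,
      Real.norm_of_nonneg hq0.le, ← ha]
    have h3 : ((2*n+1 : ℕ):ℝ) ≤ 3^n := by
      have : 2*n+1 ≤ 3^n := by
        clear hs hb
        induction n with
        | zero => simp
        | succ k ih => rw [pow_succ]; omega
      exact_mod_cast this
    calc q^(n^2) * a⁻¹^n * ‖∑ j ∈ Finset.range (2*n+1), Y^j * (-(q:ℂ))^(2*n+1-1-j)‖
        ≤ q^n * a⁻¹^n * (3^n * a^n) := by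
          gcongr ?_ * _ * ?_
          · exact pow_le_pow_of_le_one hq0.le (by linarith) (by nlinarith)
          · refine hs.trans ?_
            gcongr
      _ = (3*q)^n * (a⁻¹*a)^n := by rw [mul_pow, mul_pow]; ring
      _ = (3*q)^n := by rw [inv_mul_cancel₀ ha0.ne', one_pow, mul_one]
  intro hv
  unfold vt at hv
  rw [hv] at hsum
  simp_rw [hterm] at hsum
  have hc : Y⁻¹ * (Y+q) ≠ 0 := mul_ne_zero (inv_ne_zero hY0) hYq
  have hsr : HasSum r 0 := by
    have := hsum.mul_left (Y⁻¹ * (Y+q))⁻¹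
    simp_rw [inv_mul_cancel_left₀ hc] at this
    rwa [mul_zero] at this
  have hsr1 : HasSum (fun n => r (n+1)) (-1) := by
    have := (hasSum_nat_add_iff' 1).mpr hsr
    simpa [hr0] using this
  have hgeo : HasSum (fun n : ℕ => (3*q)^(n+1)) ((1-3*q)⁻¹*(3*q)) := by
    simp_rw [pow_succ]
    exact (hasSum_geometric_of_lt_one (by positivity) (by linarith)).mul_right _
  have := tsum_of_norm_bounded hgeo (fun n => hrb (n+1))
  rw [hsr1.tsum_eq] at this
  simp at this
  have h13 : 0 < 1-3*q := by linarith
  rw [inv_mul_eq_div, le_div_iff₀ h13] at this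
  linarith

lemma vt_ne_large {t : ℝ} (ht : 1 ≤ t) (z : ℂ) (hz : |z.re| < 1/2) : vt (t*I) z ≠ 0 := by
  have ht0 : 0 < t := by linarith
  have h1 := Int.floor_le (z.im/t)
  have h2 := Int.lt_floor_add_one (z.im/t)
  rw [le_div_iff₀ ht0] at h1
  rw [div_lt_iff₀ ht0] at h2
  rw [Ne, ← vt_int_tau _ _ (-⌊z.im/t⌋)]
  apply vt_ne_base ht
  · simp; linarith
  · simp; linarith
  · simpa using hz

lemma vt_ne_step {t : ℝ} (ht : 0 < t) (H : ∀ z : ℂ, |z.re| < 1/2 → vt ((2*t : ℝ)*I) z ≠ 0)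
    (z : ℂ) (hz : |z.re| < 1/2) : vt (t*I) z ≠ 0 := by
  intro h0
  have hd := vt_double (im_tI ht) z
  have e : 2*((t:ℂ)*I) = ((2*t : ℝ):ℂ)*I := by push_cast; ring
  rw [h0, zero_mul, e] at hd
  have h12 := vt_real_ne (t := 2*t) (by positivity) (1/2)
  push_cast at h12 hd
  have h3 : vt (2*t*I) (2*z+1/2) = 0 := by
    rcases mul_eq_zero.mp hd.symm with h | h
    · exact h
    · exact absurd h h12
  push_cast at H
  rw [abs_lt] at hz
  rcases lt_trichotomy z.re 0 with h | h | h
  · refine H _ ?_ h3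
    rw [abs_lt]; simp; constructor <;> linarith
  · apply vt_imag_ne ht z.im
    rw [← h0]; congr 1
    apply Complex.ext <;> simp [h]
  · refine H (2*z-1/2) ?_ ?_
    · rw [abs_lt]; simp; constructor <;> linarith
    · rw [← vt_add_one, ← h3]; congr 1; ring

lemma vt_ne_strip {t : ℝ} (ht : 0 < t) (z : ℂ) (hz : |z.re| < 1/2) : vt (t*I) z ≠ 0 := by
  have key : ∀ k : ℕ, ∀ s : ℝ, 0 < s → 1 ≤ 2^k * s → ∀ z : ℂ, |z.re| < 1/2 → vt (s*I) z ≠ 0 := by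
    intro k
    induction k with
    | zero => intro s _ h z hz; exact vt_ne_large (by simpa using h) z hz
    | succ k ih =>
      intro s hs h z hz
      exact vt_ne_step hs (ih (2*s) (by positivity) (by rw [pow_succ] at h; linarith)) z hz
  obtain ⟨k, hk⟩ := pow_unbounded_of_one_lt (1/t) (one_lt_two)
  rw [div_lt_iff₀ ht] at hk
  exact key k t ht hk.le z hz


/-- Symmetric product of theta functions. -/
def Gp (τ η : ℂ) (N : ℕ) (x : ℂ) : ℂ :=
  ∏ k ∈ Finset.range N, vt τ (x + (2*(k:ℂ) - N + 1)*η)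

lemma Gp_neg (τ η : ℂ) (N : ℕ) (x : ℂ) : Gp τ η N (-x) = Gp τ η N x := by
  unfold Gp
  rw [← Finset.prod_range_reflect]
  refine Finset.prod_congr rfl fun k hk => ?_
  rw [← vt_neg]
  congr 1
  rw [Finset.mem_range] at hk
  rw [Nat.cast_sub (by omega), Nat.cast_sub (by omega)]
  push_cast; ring

lemma Gp_succ (τ η : ℂ) (N : ℕ) (x : ℂ) :
    Gp τ η (N+1) x = Gp τ η N (x-η) * vt τ (x+N*η) := by
  unfold Gp
  rw [Finset.prod_range_succ]
  congr 1
  · refine Finset.prod_congr rfl fun k _ => ?_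
    congr 1; push_cast; ring
  · congr 1; push_cast; ring

lemma Gp_succ' (τ η : ℂ) (N : ℕ) (x : ℂ) :
    Gp τ η (N+1) x = Gp τ η N (x+η) * vt τ (x-N*η) := by
  unfold Gp
  rw [Finset.prod_range_succ']
  congr 1
  · refine Finset.prod_congr rfl fun k _ => ?_
    congr 1; push_cast; ring
  · congr 1; push_cast; ring

lemma Gp_add_one (τ η : ℂ) (N : ℕ) (x : ℂ) : Gp τ η N (x+1) = Gp τ η N x := by
  unfold Gp
  refine Finset.prod_congr rfl fun k _ => ?_
  rw [show x+1+(2*(k:ℂ)-N+1)*η = x+(2*(k:ℂ)-N+1)*η+1 by ring, vt_add_one]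

lemma sum_odd (N : ℕ) : ∑ k ∈ Finset.range N, (2*(k:ℂ) - N + 1) = 0 := by
  have h : ∀ M : ℕ, ∑ k ∈ Finset.range M, (2*(k:ℂ) + 1) = M^2 := by
    intro M
    induction M with
    | zero => simp
    | succ k ih => rw [Finset.sum_range_succ, ih]; push_cast; ring
  have : ∑ k ∈ Finset.range N, (2*(k:ℂ) - N + 1) =
      ∑ k ∈ Finset.range N, (2*(k:ℂ) + 1) - ∑ k ∈ Finset.range N, (N:ℂ) := by
    rw [← Finset.sum_sub_distrib]; refine Finset.sum_congr rfl fun k _ => by ring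
  rw [this, h]; simp; ring

lemma prod_exp_sum (N : ℕ) (c d : ℂ) :
    ∏ k ∈ Finset.range N, Complex.exp (c + (2*(k:ℂ) - N + 1)*d) = Complex.exp (N*c) := by
  rw [← Complex.exp_sum, Finset.sum_add_distrib, ← Finset.sum_mul, sum_odd]
  simp

lemma Gp_add_tau (τ η : ℂ) (N : ℕ) (x : ℂ) :
    Gp τ η N (x+τ) = Complex.exp (-cπ*I*N*(τ+2*x)) * Gp τ η N x := by
  have h := prod_exp_sum N (-cπ*I*(τ+2*x)) (-cπ*I*2*η)
  rw [show -cπ*I*N*(τ+2*x) = N*(-cπ*I*(τ+2*x)) by ring, ← h]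
  unfold Gp
  rw [← Finset.prod_mul_distrib]
  refine Finset.prod_congr rfl fun k _ => ?_
  rw [show x+τ+(2*(k:ℂ)-N+1)*η = x+(2*(k:ℂ)-N+1)*η+τ by ring, vt_add_tau]
  congr 2; ring

lemma Gp_sub_tau (τ η : ℂ) (N : ℕ) (x : ℂ) :
    Gp τ η N (x-τ) = Complex.exp (-cπ*I*N*(τ-2*x)) * Gp τ η N x := by
  rw [← Gp_neg, show -(x-τ) = -x+τ by ring, Gp_add_tau, Gp_neg]; congr 2; ring

lemma Gp_differentiable {τ : ℂ} (hτ : 0 < τ.im) (η : ℂ) (N : ℕ) : Differentiable ℂ (Gp τ η N) := by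
  unfold Gp
  have := vt_differentiable hτ
  fun_prop

lemma Kk_eq (τ η : ℂ) (N : ℕ) (u w : ℂ) :
    Kk τ η N u w = Complex.exp (-cπ*I*N*τ/2) * (Gp τ η N (u+w) * Gp τ η N (u-w)) := by
  have h := prod_exp_sum N (-cπ*I*(τ/2+2*u)) (-cπ*I*2*η)
  have e : Complex.exp (-cπ*I*N*τ/2) =
      Complex.exp (2*cπ*I*u*N) * Complex.exp (N*(-cπ*I*(τ/2+2*u))) := by
    rw [← Complex.exp_add]; congr 1; ring
  rw [e, ← h, mul_assoc]
  unfold Kk Gp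
  congr 1
  rw [← Finset.prod_mul_distrib, ← Finset.prod_mul_distrib]
  refine Finset.prod_congr rfl fun k _ => ?_
  rw [θf_hat, θf_hat]
  have : Complex.exp (-cπ*I*(τ/2+2*u) + (2*(k:ℂ)-N+1)*(-cπ*I*2*η)) =
      Complex.exp (-cπ*I*(τ/4+(u+w+(2*(k:ℂ)-N+1)*η))) *
      Complex.exp (-cπ*I*(τ/4+(u-w+(2*(k:ℂ)-N+1)*η))) := by
    rw [← Complex.exp_add]; congr 1; ring
  rw [this]; ring

lemma Mw_eq (τ η : ℂ) (N : ℕ) (u v : ℂ) :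
    Mw τ η N u v = Complex.exp (cπ*I*(N+2)*τ/2) *
      (θf τ (2*u) * θf τ (2*v) / (Gp τ η (N+2) (u+v) * Gp τ η (N+2) (u-v))) := by
  have h := Kk_eq τ η (N+2) u v
  have : Mw τ η N u v = θf τ (2*u) * θf τ (2*v) / Kk τ η (N+2) u v := by
    unfold Mw Kk
    congr 2
    · congr 2; push_cast; ring
    · refine Finset.prod_congr rfl fun k _ => ?_
      congr 2 <;> (push_cast; ring)
  rw [this, h, show cπ*I*(N+2)*τ/2 = -(-cπ*I*((N+2 : ℕ):ℂ)*τ/2) by push_cast; ring, Complex.exp_neg]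
  simp only [div_eq_mul_inv, mul_inv]
  ring

/-- The common building block of both sides. -/
def Pf (τ η : ℂ) (N : ℕ) (u w α z v : ℂ) : ℂ :=
  Gp τ η N (z+η/2+w) * Gp τ η N (z+η/2-w) * (Gp τ η N (u+(v+η/2)) * Gp τ η N (u-(v+η/2))) *
    (θf τ (z-u-η/2) * vt τ (z+(u-w-N*η-α)-η/2) * θf τ (v-w-η/2) * vt τ (v-α-N*η-η/2) *
      θf τ (z+v+w+α+η)) / (Gp τ η (N+2) (z+v) * Gp τ η (N+1) (z-v))

lemma Pf_swap (τ η : ℂ) (N : ℕ) (u w α z v : ℂ) :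
    Pf τ η N w u (α+w-u) v z = Pf τ η N u w α z v := by
  unfold Pf
  rw [← Gp_neg τ η N (v+η/2-u), ← Gp_neg τ η N (w-(z+η/2)), ← Gp_neg τ η (N+1) (v-z)]
  rw [show -(v+η/2-u) = u-(v+η/2) by ring, show -(w-(z+η/2)) = z+η/2-w by ring,
    show -(v-z) = z-v by ring, show v+η/2+u = u+(v+η/2) by ring, show w+(z+η/2) = z+η/2+w by ring,
    show v+z = z+v by ring, show z+v+u+(α+w-u)+η = z+v+w+α+η by ring,
    show v+(w-u-N*η-(α+w-u))-η/2 = v-α-N*η-η/2 by ring,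
    show z-(α+w-u)-N*η-η/2 = z+(u-w-N*η-α)-η/2 by ring]
  ring

def T1 (τ η : ℂ) (N : ℕ) (u w α z v : ℂ) : ℂ :=
  vt τ (z+w-N*η) * θf τ (z-u) * θf τ (z+α) * vt τ (z+(u-w-N*η-α)) *
   (Gp τ η N (z+w+η) * Gp τ η N (z-w+η)) * (Gp τ η N (u+v) * Gp τ η N (u-v)) * θf τ (2*v) /
   (Gp τ η (N+2) (z+v) * Gp τ η (N+2) (z-v))

lemma T1_split {τ : ℂ} (hτ : 0 < τ.im) (η : ℂ) (N : ℕ) (u w α z v : ℂ)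
    (hs : Gp τ η (N+2) (z+v) ≠ 0) (hd : Gp τ η (N+2) (z-v) ≠ 0) :
    vt τ (w+α+(N+2)*η) * T1 τ η N u w α z v =
      Pf τ η N u w α (z+η/2) (v-η/2) - Pf τ η N u w α (z+η/2) (-v-η/2) := by
  have h4 := four_term hτ v ((N+1)*η-z) (-α-(N+1)*η) (z+(N+1)*η+(w-N*η)+α) (-(w-N*η)-(N+1)*η) (by ring)
  have gs := Gp_succ' τ η (N+1) (z+v)
  have gd := Gp_succ' τ η (N+1) (z-v)
  have c1 : vt τ (z+v-((N+1:ℕ):ℂ)*η) = vt τ (v-((N+1)*η-z)) := by congr 1; push_cast; ring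
  have c2 : vt τ (z-v-((N+1:ℕ):ℂ)*η) = vt τ (v+((N+1)*η-z)) := by
    rw [← vt_neg]; congr 1; push_cast; ring
  rw [c1] at gs
  rw [c2] at gd
  have hs' := hs
  have hd' := hd
  rw [show N+2 = N+1+1 from rfl, gs] at hs'
  rw [show N+2 = N+1+1 from rfl, gd] at hd'
  have n1 := left_ne_zero_of_mul hs'
  have n2 := right_ne_zero_of_mul hs'
  have n3 := left_ne_zero_of_mul hd'
  have n4 := right_ne_zero_of_mul hd'
  unfold T1 Pf
  rw [show z+η/2+η/2+w = z+w+η by ring, show z+η/2+η/2-w = z-w+η by ring,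
    show v-η/2+η/2 = v by ring, show -v-η/2+η/2 = -v by ring, show u+-v = u-v by ring,
    show u- -v = u+v by ring, show z+η/2-u-η/2 = z-u by ring,
    show z+η/2+(u-w-N*η-α)-η/2 = z+(u-w-N*η-α) by ring,
    show v-η/2-w-η/2 = v+(-(w-N*η)-(N+1)*η) by ring,
    show v-η/2-α-N*η-η/2 = v+(-α-(N+1)*η) by ring,
    show z+η/2+(v-η/2)+w+α+η = v+(z+(N+1)*η+(w-N*η)+α) by ring,
    show -v-η/2-w-η/2 = -(v-(-(w-N*η)-(N+1)*η)) by ring,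
    show -v-η/2-α-N*η-η/2 = -(v-(-α-(N+1)*η)) by ring,
    show z+η/2+(-v-η/2)+w+α+η = -(v-(z+(N+1)*η+(w-N*η)+α)) by ring,
    show z+η/2+(v-η/2) = z+v by ring, show z+η/2-(v-η/2) = z-v+η by ring,
    show z+η/2+(-v-η/2) = z-v by ring, show z+η/2-(-v-η/2) = z+v+η by ring,
    θf_neg, θf_neg, vt_neg]
  rw [show (N+1)*η-z+(z+(N+1)*η+(w-N*η)+α) = w+α+(N+2)*η by ring,
    show (N+1)*η-z+(-(w-N*η)-(N+1)*η) = -(z+w-N*η) by ring, vt_neg,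
    show z+(N+1)*η+(w-N*η)+α+(-(w-N*η)-(N+1)*η) = z+α by ring] at h4
  rw [show N+2 = N+1+1 from rfl, gs, gd]
  generalize vt τ (v-((N+1)*η-z)) = a1 at *
  generalize vt τ (v+((N+1)*η-z)) = a2 at *
  generalize vt τ (v+(-α-(N+1)*η)) = a3 at *
  generalize vt τ (v-(-α-(N+1)*η)) = a4 at *
  generalize θf τ (v+(z+(N+1)*η+(w-N*η)+α)) = a5 at *
  generalize θf τ (v-(z+(N+1)*η+(w-N*η)+α)) = a6 at *
  generalize θf τ (v+(-(w-N*η)-(N+1)*η)) = a7 at *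
  generalize θf τ (v-(-(w-N*η)-(N+1)*η)) = a8 at *
  generalize Gp τ η (N+1) (z+v+η) = g1 at *
  generalize Gp τ η (N+1) (z-v+η) = g2 at *
  field_simp
  linear_combination (-(θf τ (z-u) * vt τ (z+(u-w-N*η-α)) * Gp τ η N (z+w+η) * Gp τ η N (z-w+η) *
    Gp τ η N (u+v) * Gp τ η N (u-v))) * h4

lemma T1_sum {τ : ℂ} (hτ : 0 < τ.im) (η : ℂ) (N : ℕ) (u w α z v : ℂ) :
    θf τ (α-u) * vt τ (w+N*η+α) * vt τ (u-w-N*η) *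
      (Gp τ η N (z+(w-η)) * Gp τ η N (z-(w-η)) * (Gp τ η N (u+v) * Gp τ η N (u-v)) *
      (θf τ (2*z) * θf τ (2*v) / (Gp τ η (N+2) (z+v) * Gp τ η (N+2) (z-v)))) =
    T1 τ η N u w α z v + T1 τ η N u w α (-z) (-v) := by
  have h4 := four_term hτ z (w+N*η) (u-w-N*η-α) (-u) α (by ring)
  have g1 := Gp_succ τ η N (z+w)
  rw [Gp_succ'] at g1
  have g2 := Gp_succ τ η N (-z+w)
  rw [Gp_succ'] at g2
  unfold T1
  have e1 : Gp τ η (N+2) (-z+-v) = Gp τ η (N+2) (z+v) := by rw [← Gp_neg]; congr 1; ring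
  have e2 : Gp τ η (N+2) (-z- -v) = Gp τ η (N+2) (z-v) := by rw [← Gp_neg]; congr 1; ring
  have e3 : Gp τ η N (-z+w-η) = Gp τ η N (z-w+η) := by rw [← Gp_neg]; congr 1; ring
  have e4 : Gp τ η N (-z-w+η) = Gp τ η N (z+w-η) := by rw [← Gp_neg]; congr 1; ring
  have e5 : vt τ (-z+w+N*η) = vt τ (z-(w+N*η)) := by rw [← vt_neg]; congr 1; ring
  have e6 : θf τ (-z-u) = -θf τ (z-(-u)) := by rw [← θf_neg]; congr 1; ring
  have e7 : θf τ (-z+α) = -θf τ (z-α) := by rw [← θf_neg]; congr 1; ring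
  have e8 : vt τ (-z+(u-w-N*η-α)) = vt τ (z-(u-w-N*η-α)) := by rw [← vt_neg]; congr 1; ring
  have e9 : vt τ (w+N*η+ -u) = vt τ (u-w-N*η) := by rw [← vt_neg]; congr 1; ring
  rw [e3, e5] at g2
  rw [show z+w+N*η = z+(w+N*η) by ring] at g1
  rw [e1, e2, e4, e6, e7, e8, show u+-v = u-v by ring, show u- -v = u+v by ring,
    show 2*-v = -(2*v) by ring, θf_neg, show z+(w-η) = z+w-η by ring,
    show z-(w-η) = z-w+η by ring]
  rw [e9, show -u+α = α-u by ring, show z+-u = z-u by ring] at h4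
  generalize Gp τ η (N+2) (z+v) = d1
  generalize Gp τ η (N+2) (z-v) = d2
  simp only [div_eq_mul_inv]
  generalize (d1*d2)⁻¹ = d
  linear_combination (-(Gp τ η N (z+w-η) * Gp τ η N (z-w+η) * (Gp τ η N (u+v) * Gp τ η N (u-v)) *
    θf τ (2*v) * d)) * h4
    - (θf τ (z-u) * θf τ (z+α) * vt τ (z+(u-w-N*η-α)) * Gp τ η N (z-w+η) *
      (Gp τ η N (u+v) * Gp τ η N (u-v)) * θf τ (2*v) * d) * g1
    + (θf τ (z- -u) * θf τ (z-α) * vt τ (z-(u-w-N*η-α)) * Gp τ η N (z+w-η) *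
      (Gp τ η N (u+v) * Gp τ η N (u-v)) * θf τ (2*v) * d) * g2

/-- Reduced integrand of `Φ(u,w)`. -/
def Rf (τ η : ℂ) (N : ℕ) (u w z v : ℂ) : ℂ :=
  Gp τ η N (z+w) * Gp τ η N (z-w) * (Gp τ η N (u+v) * Gp τ η N (u-v)) *
      (θf τ (2*z) * θf τ (2*v) / (Gp τ η (N+2) (z+v) * Gp τ η (N+2) (z-v)))

lemma left_identity {τ : ℂ} (hτ : 0 < τ.im) (η : ℂ) (N : ℕ) (u w α z v : ℂ)
    (hs : Gp τ η (N+2) (z+v) ≠ 0) (hd : Gp τ η (N+2) (z-v) ≠ 0) :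
    vt τ (w+α+(N+2)*η) * θf τ (α-u) * vt τ (w+N*η+α) * vt τ (u-w-N*η) * Rf τ η N u (w-η) z v =
    Pf τ η N u w α (z+η/2) (v-η/2) - Pf τ η N u w α (z+η/2) (-v-η/2)
      + (Pf τ η N u w α (-z+η/2) (-v-η/2) - Pf τ η N u w α (-z+η/2) (v-η/2)) := by
  have h1 := T1_split hτ η N u w α z v hs hd
  have h2 := T1_split hτ η N u w α (-z) (-v)
    (by rw [← Gp_neg]; convert hs using 2; ring) (by rw [← Gp_neg]; convert hd using 2; ring)
  have h3 := T1_sum hτ η N u w α z v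
  rw [neg_neg] at h2
  unfold Rf
  linear_combination vt τ (w+α+(N+2)*η) * h3 + h1 + h2

lemma right_identity {τ : ℂ} (hτ : 0 < τ.im) (η : ℂ) (N : ℕ) (u w α z v : ℂ)
    (hs : Gp τ η (N+2) (z+v) ≠ 0) (hd : Gp τ η (N+2) (z-v) ≠ 0) :
    vt τ (w+α+(N+2)*η) * θf τ (α-u) * vt τ (w+N*η+α) * vt τ (u-w+N*η) * Rf τ η N (u-η) w z v =
    Pf τ η N u w α (z-η/2) (v+η/2) - Pf τ η N u w α (-z-η/2) (v+η/2)
      + (Pf τ η N u w α (-z-η/2) (-v+η/2) - Pf τ η N u w α (z-η/2) (-v+η/2)) := by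
  have h := left_identity hτ η N w u (α+w-u) v z
    (by convert hs using 2; ring) (by rw [← Gp_neg]; convert hd using 2; ring)
  simp only [Pf_swap] at h
  rw [← h]
  have e1 : vt τ (w-u-N*η) = vt τ (u-w+N*η) := by rw [← vt_neg]; congr 1; ring
  have e2 : Gp τ η N (v-(u-η)) = Gp τ η N (u-η-v) := by rw [← Gp_neg]; congr 1; ring
  have e3 : Gp τ η N (w-z) = Gp τ η N (z-w) := by rw [← Gp_neg]; congr 1; ring
  have e4 : Gp τ η (N+2) (v-z) = Gp τ η (N+2) (z-v) := by rw [← Gp_neg]; congr 1; ring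
  unfold Rf
  rw [e1, e2, e3, e4, show v+(u-η) = u-η+v by ring, show w+z = z+w by ring, show v+z = z+v by ring,
    show u+(α+w-u)+(N+2)*η = w+α+(N+2)*η by ring, show α+w-u-w = α-u by ring,
    show u+N*η+(α+w-u) = w+N*η+α by ring]
  ring


/-- Double integral over the period rectangle. -/
def dI (t : ℝ) (f : ℝ → ℝ → ℂ) : ℂ := ∫ y in (0:ℝ)..t, ∫ x in (0:ℝ)..(1:ℝ), f x y

lemma cont_swap {f : ℝ → ℝ → ℂ} (hf : Continuous (fun p : ℝ × ℝ => f p.1 p.2)) :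
    Continuous (fun p : ℝ × ℝ => f p.2 p.1) :=
  hf.comp (continuous_snd.prodMk continuous_fst)

lemma dI_inner_cont {f : ℝ → ℝ → ℂ} (hf : Continuous (fun p : ℝ × ℝ => f p.1 p.2)) :
    Continuous (fun y => ∫ x in (0:ℝ)..(1:ℝ), f x y) :=
  intervalIntegral.continuous_parametric_intervalIntegral_of_continuous'
    (f := fun y x => f x y) (cont_swap hf) 0 1

lemma dI_add (t : ℝ) {f g : ℝ → ℝ → ℂ} (hf : Continuous (fun p : ℝ × ℝ => f p.1 p.2))
    (hg : Continuous (fun p : ℝ × ℝ => g p.1 p.2)) :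
    dI t (fun x y => f x y + g x y) = dI t f + dI t g := by
  unfold dI
  rw [← intervalIntegral.integral_add ((dI_inner_cont hf).intervalIntegrable _ _)
    ((dI_inner_cont hg).intervalIntegrable _ _)]
  congr 1
  funext y
  have h1 : Continuous (fun x => f x y) := hf.comp (continuous_id.prodMk continuous_const)
  have h2 : Continuous (fun x => g x y) := hg.comp (continuous_id.prodMk continuous_const)
  exact intervalIntegral.integral_add (h1.intervalIntegrable _ _) (h2.intervalIntegrable _ _)

lemma dI_sub (t : ℝ) {f g : ℝ → ℝ → ℂ} (hf : Continuous (fun p : ℝ × ℝ => f p.1 p.2))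
    (hg : Continuous (fun p : ℝ × ℝ => g p.1 p.2)) :
    dI t (fun x y => f x y - g x y) = dI t f - dI t g := by
  unfold dI
  rw [← intervalIntegral.integral_sub ((dI_inner_cont hf).intervalIntegrable _ _)
    ((dI_inner_cont hg).intervalIntegrable _ _)]
  congr 1
  funext y
  have h1 : Continuous (fun x => f x y) := hf.comp (continuous_id.prodMk continuous_const)
  have h2 : Continuous (fun x => g x y) := hg.comp (continuous_id.prodMk continuous_const)
  exact intervalIntegral.integral_sub (h1.intervalIntegrable _ _) (h2.intervalIntegrable _ _)

lemma dI_mul (t : ℝ) (c : ℂ) (f : ℝ → ℝ → ℂ) :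
    dI t (fun x y => c * f x y) = c * dI t f := by
  unfold dI
  simp only [intervalIntegral.integral_const_mul]

lemma dI_swap (t : ℝ) {f : ℝ → ℝ → ℂ} (hf : Continuous (fun p : ℝ × ℝ => f p.1 p.2)) :
    dI t f = ∫ x in (0:ℝ)..(1:ℝ), ∫ y in (0:ℝ)..t, f x y := by
  unfold dI
  refine MeasureTheory.intervalIntegral_intervalIntegral_swap (F := fun y x => f x y) ?_
  have hk : IsCompact (Set.uIcc 0 t ×ˢ Set.uIcc (0:ℝ) 1) := isCompact_uIcc.prod isCompact_uIcc
  have h := ((cont_swap hf).continuousOn (s := Set.uIcc 0 t ×ˢ Set.uIcc (0:ℝ) 1)).integrableOn_compact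
    (μ := volume) hk
  exact h.mono_set (Set.prod_mono Set.uIoc_subset_uIcc Set.uIoc_subset_uIcc)

/-- Regularity of the building block where needed. -/
structure Reg (τ : ℂ) (η : ℝ) (F : ℂ → ℂ → ℂ) : Prop where
  d1 : ∀ z v : ℂ, (z+v).im = 0 → |(z-v).re| ≤ |η| →
    DifferentiableAt ℂ (fun p : ℂ × ℂ => F p.1 p.2) (z,v)
  d2 : ∀ z v : ℂ, (z+v).re = 0 → (z-v).im = 0 →
    DifferentiableAt ℂ (fun p : ℂ × ℂ => F p.1 p.2) (z,v)
  p1 : ∀ z v : ℂ, F (z+1) (v-1) = F z v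
  p2 : ∀ z v : ℂ, F (z+τ) (v-τ) = F z v

lemma Reg.neg {τ : ℂ} {η : ℝ} {F : ℂ → ℂ → ℂ} (h : Reg τ η F) :
    Reg τ η (fun z v => F (-z) (-v)) where
  d1 z v h1 h2 := by
    have := h.d1 (-z) (-v) (by simp at *; linarith)
      (by rw [show -z- -v = -(z-v) by ring, Complex.neg_re, abs_neg]; exact h2)
    exact DifferentiableAt.comp (z,v) (f := fun p : ℂ × ℂ => (-p.1,-p.2))
      (g := fun p : ℂ × ℂ => F p.1 p.2) this (by fun_prop)
  d2 z v h1 h2 := by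
    have := h.d2 (-z) (-v) (by simp at *; linarith) (by simp at *; linarith)
    exact DifferentiableAt.comp (z,v) (f := fun p : ℂ × ℂ => (-p.1,-p.2))
      (g := fun p : ℂ × ℂ => F p.1 p.2) this (by fun_prop)
  p1 z v := by
    have := h.p1 (-z-1) (-v+1)
    rw [← sub_eq_zero] at *
    rw [← neg_eq_zero, ← this]; ring_nf
  p2 z v := by
    have := h.p2 (-z-τ) (-v+τ)
    rw [← sub_eq_zero] at *
    rw [← neg_eq_zero, ← this]; ring_nf

lemma Reg.c1 {τ : ℂ} {η : ℝ} {F : ℂ → ℂ → ℂ} (h : Reg τ η F) (r : ℝ) (hr : |2*r| ≤ |η|) :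
    Continuous (fun p : ℝ × ℝ => F (p.1+p.2*I+r) (p.1-p.2*I-r)) := by
  rw [continuous_iff_continuousAt]
  rintro ⟨x, y⟩
  have := (h.d1 (x+y*I+r) (x-y*I-r) (by simp) (by simpa [← two_mul] using hr)).continuousAt
  exact ContinuousAt.comp (x := (x,y)) (f := fun p : ℝ × ℝ => ((p.1+p.2*I+r : ℂ),(p.1-p.2*I-r : ℂ)))
      (g := fun p : ℂ × ℂ => F p.1 p.2) this (by fun_prop)

lemma Reg.c2 {τ : ℂ} {η : ℝ} {F : ℂ → ℂ → ℂ} (h : Reg τ η F) (r : ℝ) :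
    Continuous (fun p : ℝ × ℝ => F (p.1+p.2*I+r) (-(p.1-p.2*I)-r)) := by
  rw [continuous_iff_continuousAt]
  rintro ⟨x, y⟩
  have := (h.d2 (x+y*I+r) (-(x-y*I)-r) (by simp) (by simp)).continuousAt
  exact ContinuousAt.comp (x := (x,y)) (f := fun p : ℝ × ℝ => ((p.1+p.2*I+r : ℂ),(-(p.1-p.2*I)-r : ℂ)))
      (g := fun p : ℂ × ℂ => F p.1 p.2) this (by fun_prop)

lemma Reg.X {τ : ℂ} {η : ℝ} {F : ℂ → ℂ → ℂ} (h : Reg τ η F) (t r : ℝ) :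
    dI t (fun x y => F (x+y*I+r) (-(x-y*I)-r)) = dI t (fun x y => F (x+y*I-r) (-(x-y*I)+r)) := by
  unfold dI
  congr 1
  funext y
  set g : ℝ → ℂ := fun x => F (x+y*I) (-(x-y*I)) with hg
  have hp : Function.Periodic g 1 := by
    intro x
    simp only [hg]
    rw [← h.p1 (x+y*I)]
    congr 1 <;> (push_cast; ring)
  have e1 : ∫ x in (0:ℝ)..1, F (x+y*I+r) (-(x-y*I)-r) = ∫ x in (0:ℝ)..1, g (x+r) := by
    congr 1; funext x; simp only [hg]; congr 1 <;> (push_cast; ring)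
  have e2 : ∫ x in (0:ℝ)..1, F (x+y*I-r) (-(x-y*I)+r) = ∫ x in (0:ℝ)..1, g (x+(-r)) := by
    congr 1; funext x; simp only [hg]; congr 1 <;> (push_cast; ring)
  rw [e1, e2, intervalIntegral.integral_comp_add_right, intervalIntegral.integral_comp_add_right]
  have := hp.intervalIntegral_add_eq (0+r) (0+-r)
  rw [show (1:ℝ)+r = 0+r+1 by ring, show (1:ℝ)+-r = 0+-r+1 by ring]
  exact this

lemma Reg.Y {t : ℝ} {η : ℝ} {F : ℂ → ℂ → ℂ} (h : Reg (t*I) η F) (r : ℝ)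
    (hr : |2*r| ≤ |η|) :
    dI t (fun x y => F (x+y*I+r) (x-y*I-r)) = dI t (fun x y => F (x+y*I-r) (x-y*I+r)) := by
  have hr2 : |2*(-r)| ≤ |η| := by rwa [mul_neg, abs_neg]
  have e : (fun (x y : ℝ) => F (x+y*I-r) (x-y*I+r)) =
      (fun (x y : ℝ) => F (x+y*I+(-r:ℝ)) (x-y*I-(-r:ℝ))) := by
    funext x y; congr 1 <;> (push_cast; ring)
  rw [e, dI_swap t (h.c1 r hr), dI_swap t (h.c1 (-r) hr2)]
  congr 1
  funext x
  have H := Complex.integral_boundary_rect_eq_zero_of_differentiableOn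
    (fun ζ => F (x+ζ) (x-ζ)) ((-r:ℝ)+(0:ℝ)*I) ((r:ℝ)+(t:ℝ)*I) ?_
  · simp only [Complex.add_re, Complex.add_im, Complex.ofReal_re, Complex.ofReal_im,
      Complex.re_ofReal_mul, Complex.im_ofReal_mul, Complex.I_re, Complex.I_im, mul_zero, mul_one,
      add_zero, zero_add] at H
    have e3 : ∀ s : ℝ, F (x+(s+(t:ℂ)*I)) (x-(s+(t:ℂ)*I)) = F (x+(s+((0:ℝ):ℂ)*I)) (x-(s+((0:ℝ):ℂ)*I)) := by
      intro s
      rw [← h.p2 (x+(s+((0:ℝ):ℂ)*I))]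
      congr 1 <;> (push_cast; ring)
    simp only [e3, sub_self, zero_add, smul_eq_mul, ← mul_sub] at H
    have H2 := (mul_eq_zero.mp H).resolve_left I_ne_zero
    rw [sub_eq_zero] at H2
    have q : ∀ s y : ℝ, F (x+y*I+s) (x-y*I-s) = F (x+(s+y*I)) (x-(s+y*I)) := by
      intro s y; congr 1 <;> ring
    simp only [q]
    exact H2
  · intro ζ hζ
    rw [Complex.mem_reProdIm] at hζ
    have h1 := hζ.1
    simp at h1
    have h2 : |2*ζ.re| ≤ |η| := by
      refine le_trans ?_ hr
      rw [Set.mem_uIcc] at h1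
      rw [abs_mul, abs_mul]
      have : |ζ.re| ≤ |r| := by
        rw [abs_le]
        have := le_abs_self r
        have := neg_abs_le r
        constructor <;> rcases h1 with h1 | h1 <;> linarith [h1.1, h1.2]
      gcongr
    have := h.d1 (x+ζ) (x-ζ) (by simp) (by simpa [← two_mul] using h2)
    have h3 := DifferentiableAt.comp ζ (f := fun ζ : ℂ => ((x+ζ : ℂ),(x-ζ : ℂ)))
      (g := fun p : ℂ × ℂ => F p.1 p.2) this (by fun_prop)
    exact h3.differentiableWithinAt


lemma θf_sub_tau (τ x : ℂ) : θf τ (x-τ) = -Complex.exp (-cπ*I*(τ-2*x)) * θf τ x := by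
  have : θf τ (x-τ) = -θf τ (-x+τ) := by rw [← θf_neg]; congr 1; ring
  rw [this, θf_add_tau, θf_neg, show τ+2*-x = τ-2*x by ring]; ring

lemma θf_sub_one (τ x : ℂ) : θf τ (x-1) = -θf τ x := by
  have := θf_add_one τ (x-1)
  rw [sub_add_cancel] at this
  rw [this, neg_neg]

lemma vt_sub_one (τ x : ℂ) : vt τ (x-1) = vt τ x := by
  have := vt_add_one τ (x-1)
  rw [sub_add_cancel] at this
  exact this.symm

lemma Gp_sub_one (τ η : ℂ) (N : ℕ) (x : ℂ) : Gp τ η N (x-1) = Gp τ η N x := by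
  have := Gp_add_one τ η N (x-1)
  rw [sub_add_cancel] at this
  exact this.symm

lemma Pf_p1 (τ η : ℂ) (N : ℕ) (u w α z v : ℂ) :
    Pf τ η N u w α (z+1) (v-1) = Pf τ η N u w α z v := by
  unfold Pf
  rw [show z+1+η/2+w = z+η/2+w+1 by ring, show z+1+η/2-w = z+η/2-w+1 by ring,
    show u+(v-1+η/2) = u+(v+η/2)-1 by ring, show u-(v-1+η/2) = u-(v+η/2)+1 by ring,
    show z+1-u-η/2 = z-u-η/2+1 by ring,
    show z+1+(u-w-N*η-α)-η/2 = z+(u-w-N*η-α)-η/2+1 by ring,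
    show v-1-w-η/2 = v-w-η/2-1 by ring, show v-1-α-N*η-η/2 = v-α-N*η-η/2-1 by ring,
    show z+1+(v-1) = z+v by ring, show z+1-(v-1) = z-v+1+1 by ring]
  simp only [Gp_add_one, Gp_sub_one, θf_add_one, θf_sub_one, vt_add_one, vt_sub_one]
  ring

lemma Pf_p2 (τ η : ℂ) (N : ℕ) (u w α z v : ℂ) :
    Pf τ η N u w α (z+τ) (v-τ) = Pf τ η N u w α z v := by
  unfold Pf
  rw [show z+τ+η/2+w = z+η/2+w+τ by ring, show z+τ+η/2-w = z+η/2-w+τ by ring,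
    show u+(v-τ+η/2) = u+(v+η/2)-τ by ring, show u-(v-τ+η/2) = u-(v+η/2)+τ by ring,
    show z+τ-u-η/2 = z-u-η/2+τ by ring,
    show z+τ+(u-w-N*η-α)-η/2 = z+(u-w-N*η-α)-η/2+τ by ring,
    show v-τ-w-η/2 = v-w-η/2-τ by ring, show v-τ-α-N*η-η/2 = v-α-N*η-η/2-τ by ring,
    show z+τ+(v-τ) = z+v by ring, show z+τ-(v-τ) = z-v+τ+τ by ring]
  simp only [Gp_add_tau, Gp_sub_tau, θf_add_tau, θf_sub_tau, vt_add_tau, vt_sub_tau]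
  have hE : Complex.exp (-cπ*I*((N+1:ℕ):ℂ)*(τ+2*(z-v+τ))) * Complex.exp (-cπ*I*((N+1:ℕ):ℂ)*(τ+2*(z-v))) =
    Complex.exp (-cπ*I*N*(τ+2*(z+η/2+w))) * Complex.exp (-cπ*I*N*(τ+2*(z+η/2-w))) *
    Complex.exp (-cπ*I*N*(τ-2*(u+(v+η/2)))) * Complex.exp (-cπ*I*N*(τ+2*(u-(v+η/2)))) *
    Complex.exp (-cπ*I*(τ+2*(z-u-η/2))) * Complex.exp (-cπ*I*(τ+2*(z+(u-w-N*η-α)-η/2))) *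
    Complex.exp (-cπ*I*(τ-2*(v-w-η/2))) * Complex.exp (-cπ*I*(τ-2*(v-α-N*η-η/2))) := by
    simp only [← Complex.exp_add]
    congr 1; push_cast; ring
  have hE0 : Complex.exp (-cπ*I*((N+1:ℕ):ℂ)*(τ+2*(z-v+τ))) *
    Complex.exp (-cπ*I*((N+1:ℕ):ℂ)*(τ+2*(z-v))) ≠ 0 :=
    mul_ne_zero (Complex.exp_ne_zero _) (Complex.exp_ne_zero _)
  rw [← mul_div_mul_left _ (Gp τ η (N+2) (z+v) * Gp τ η (N+1) (z-v)) hE0]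
  congr 1
  · rw [hE]; ring
  · ring

lemma Gp_real_ne {t : ℝ} (ht : 0 < t) (η : ℝ) (N : ℕ) (x : ℂ) (hx : x.im = 0) :
    Gp (t*I) η N x ≠ 0 := by
  unfold Gp
  refine Finset.prod_ne_zero_iff.mpr fun k _ => ?_
  have h := vt_real_ne ht (x.re + (2*(k:ℝ)-N+1)*η)
  convert h using 2
  apply Complex.ext <;> simp [hx]

lemma Gp_strip_ne {t : ℝ} (ht : 0 < t) (η : ℝ) (N : ℕ) (x : ℂ) (hx : |x.re| + N*|η| < 1/2) :
    Gp (t*I) η (N+1) x ≠ 0 := by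
  unfold Gp
  refine Finset.prod_ne_zero_iff.mpr fun k hk => ?_
  refine vt_ne_strip ht _ ?_
  rw [Finset.mem_range] at hk
  have hk' : (k:ℝ) ≤ N := by exact_mod_cast Nat.lt_succ_iff.mp hk
  have e : (x + (2*(k:ℂ) - ((N+1:ℕ):ℂ) + 1)*(η:ℂ)).re = x.re + (2*(k:ℝ)-N)*η := by
    have : (2*(k:ℂ) - ((N+1:ℕ):ℂ) + 1)*(η:ℂ) = (((2*(k:ℝ)-N)*η : ℝ) : ℂ) := by push_cast; ring
    rw [this, Complex.add_re, Complex.ofReal_re]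
  rw [e]
  refine lt_of_le_of_lt (abs_add_le _ _) (lt_of_le_of_lt ?_ hx)
  rw [abs_mul]
  have : |2*(k:ℝ)-N| ≤ N := by
    have : (0:ℝ) ≤ k := Nat.cast_nonneg k
    rw [abs_le]; constructor <;> linarith
  gcongr

lemma eta_bound {N : ℕ} {η : ℝ} (hη : |η| < 1 / (2 * (N + 1))) : (N+1:ℝ)*|η| < 1/2 := by
  have : (0:ℝ) < 2*(N+1) := by positivity
  rw [lt_div_iff₀ this] at hη
  linarith

lemma Pf_diffAt {τ : ℂ} (hτ : 0 < τ.im) (η : ℂ) (N : ℕ) (u w α z v : ℂ)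
    (h1 : Gp τ η (N+2) (z+v) ≠ 0) (h2 : Gp τ η (N+1) (z-v) ≠ 0) :
    DifferentiableAt ℂ (fun p : ℂ × ℂ => Pf τ η N u w α p.1 p.2) (z,v) := by
  unfold Pf
  have a1 := Gp_differentiable hτ η N
  have a2 := Gp_differentiable hτ η (N+1)
  have a3 := Gp_differentiable hτ η (N+2)
  have a4 := vt_differentiable hτ
  have a5 := θf_differentiable hτ
  simp only [div_eq_mul_inv]
  refine DifferentiableAt.fun_mul ?_ (DifferentiableAt.fun_inv ?_ (mul_ne_zero h1 h2))
  · refine Differentiable.differentiableAt ?_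
    fun_prop
  · refine Differentiable.differentiableAt ?_
    fun_prop

lemma Pf_reg {t : ℝ} (ht : 0 < t) (η : ℝ) (N : ℕ) (hη : |η| < 1 / (2 * (N + 1))) (u w α : ℂ) :
    Reg (t*I) η (Pf (t*I) η N u w α) where
  d1 z v h1 h2 := by
    have hb := eta_bound hη
    refine Pf_diffAt (im_tI ht) _ _ _ _ _ _ _ (Gp_real_ne ht _ _ _ h1) (Gp_strip_ne ht _ _ _ ?_)
    linarith
  d2 z v h1 h2 := by
    have hb := eta_bound hη
    refine Pf_diffAt (im_tI ht) _ _ _ _ _ _ _ (Gp_strip_ne ht _ (N+1) _ ?_) (Gp_real_ne ht _ _ _ h2)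
    rw [h1]; push_cast; simpa using hb
  p1 z v := Pf_p1 _ _ _ _ _ _ _ _
  p2 z v := Pf_p2 _ _ _ _ _ _ _ _

lemma dI_Rf_rel {t : ℝ} (ht : 0 < t) (η : ℝ) (N : ℕ) (hη : |η| < 1 / (2 * (N + 1))) (u w α : ℂ) :
    vt (t*I) (w+α+(N+2)*η) * θf (t*I) (α-u) * vt (t*I) (w+N*η+α) * vt (t*I) (u-w-N*η) *
      dI t (fun x y => Rf (t*I) η N u (w-η) (x+y*I) (x-y*I)) =
    vt (t*I) (w+α+(N+2)*η) * θf (t*I) (α-u) * vt (t*I) (w+N*η+α) * vt (t*I) (u-w+N*η) *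
      dI t (fun x y => Rf (t*I) η N (u-η) w (x+y*I) (x-y*I)) := by
  have hb := eta_bound hη
  have hR := Pf_reg ht η N hη u w α
  set F := Pf (t*I) η N u w α with hF
  have hs : ∀ x y : ℝ, Gp (t*I) η (N+2) (((x:ℂ)+y*I)+(x-y*I)) ≠ 0 := fun x y =>
    Gp_real_ne ht _ _ _ (by simp)
  have hd : ∀ x y : ℝ, Gp (t*I) η (N+2) (((x:ℂ)+y*I)-(x-y*I)) ≠ 0 := fun x y =>
    Gp_strip_ne ht _ (N+1) _ (by push_cast; simpa using hb)
  have hn := hR.neg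
  have b1 : |2*(η/2)| ≤ |η| := by rw [mul_div_cancel₀ η two_ne_zero]
  have b2 : |2*(-(η/2))| ≤ |η| := by rw [mul_neg, abs_neg]; exact b1
  rw [← dI_mul, ← dI_mul]
  have L : dI t (fun x y => vt (t*I) (w+α+(N+2)*η) * θf (t*I) (α-u) * vt (t*I) (w+N*η+α) *
      vt (t*I) (u-w-N*η) * Rf (t*I) η N u (w-η) (x+y*I) (x-y*I)) =
      dI t (fun x y => F (x+y*I+(η/2:ℝ)) (x-y*I-(η/2:ℝ)))
      - dI t (fun x y => F (x+y*I+(η/2:ℝ)) (-(x-y*I)-(η/2:ℝ)))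
      + (dI t (fun x y => F (-(x+y*I+(-(η/2):ℝ))) (-(x-y*I-(-(η/2):ℝ))))
      - dI t (fun x y => F (-(x+y*I+(-(η/2):ℝ))) (-(-(x-y*I)-(-(η/2):ℝ))))) := by
    have k1 := hR.c1 _ b1
    have k2 := hR.c2 (η/2)
    have k3 := hn.c1 _ b2
    have k4 := hn.c2 (-(η/2))
    rw [← dI_sub t k1 k2, ← dI_sub t k3 k4, ← dI_add t (k1.sub k2) (k3.sub k4)]
    congr 1
    funext x y
    rw [left_identity (im_tI ht) _ _ _ _ _ _ _ (hs x y) (hd x y), ← hF]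
    push_cast
    ring_nf
  have R : dI t (fun x y => vt (t*I) (w+α+(N+2)*η) * θf (t*I) (α-u) * vt (t*I) (w+N*η+α) *
      vt (t*I) (u-w+N*η) * Rf (t*I) η N (u-η) w (x+y*I) (x-y*I)) =
      dI t (fun x y => F (x+y*I+(-(η/2):ℝ)) (x-y*I-(-(η/2):ℝ)))
      - dI t (fun x y => F (x+y*I+(-(η/2):ℝ)) (-(x-y*I)-(-(η/2):ℝ)))
      + (dI t (fun x y => F (-(x+y*I+(η/2:ℝ))) (-(x-y*I-(η/2:ℝ))))
      - dI t (fun x y => F (-(x+y*I+(η/2:ℝ))) (-(-(x-y*I)-(η/2:ℝ))))) := by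
    have k1 := hR.c1 _ b2
    have k2 := hR.c2 (-(η/2))
    have k3 := hn.c1 _ b1
    have k4 := hn.c2 (η/2)
    rw [← dI_sub t k1 k2, ← dI_sub t k3 k4, ← dI_add t (k1.sub k2) (k3.sub k4)]
    congr 1
    funext x y
    rw [right_identity (im_tI ht) _ _ _ _ _ _ _ (hs x y) (hd x y), ← hF]
    push_cast
    ring_nf
  rw [L, R]
  have y1 := hR.Y _ b1
  have x1 := hR.X t (η/2)
  have y2 := hn.Y _ b1
  have x2 := hn.X t (η/2)
  simp only [Complex.ofReal_neg, sub_neg_eq_add, ← sub_eq_add_neg] at *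
  rw [y1, x1, y2, x2]


lemma Rf_rel {t : ℝ} (ht : 0 < t) (η : ℝ) (N : ℕ) (hη : |η| < 1 / (2 * (N + 1))) (u w : ℂ) :
    vt (t*I) (u-w-N*η) * dI t (fun x y => Rf (t*I) η N u (w-η) (x+y*I) (x-y*I)) =
    vt (t*I) (u-w+N*η) * dI t (fun x y => Rf (t*I) η N (u-η) w (x+y*I) (x-y*I)) := by
  set r : ℝ := 1/2 + w.re + u.re with hr
  have h := dI_Rf_rel ht η N hη u w (-w+r)
  have n1 : vt (t*I) (w+(-w+r)+(N+2)*η) ≠ 0 := by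
    convert vt_real_ne ht (r+(N+2)*η) using 2; push_cast; ring
  have n2 : vt (t*I) (w+N*η+(-w+r)) ≠ 0 := by
    convert vt_real_ne ht (r+N*η) using 2; push_cast; ring
  have n3 : θf (t*I) (-w+r-u) ≠ 0 := by
    rw [θf_eq]
    refine mul_ne_zero (mul_ne_zero I_ne_zero (Complex.exp_ne_zero _)) ?_
    rw [← vt_sub_one]
    refine vt_ne_strip ht _ ?_
    have : (-w+(r:ℂ)-u+1/2-(t:ℂ)*I/2-1).re = 0 := by
      have e : -w+(r:ℂ)-u+1/2-(t:ℂ)*I/2-1 = -w+(r:ℂ)-u-(1/2:ℝ)-((t/2:ℝ):ℂ)*I := by push_cast; ring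
      rw [e]
      simp [hr]
      ring
    rw [this]; norm_num
  have n := mul_ne_zero (mul_ne_zero n1 n3) n2
  apply mul_left_cancel₀ n
  linear_combination h

lemma conj_z (x y : ℝ) : (starRingEnd ℂ) ((x:ℂ)+(y:ℂ)*I) = x-y*I := by
  simp [sub_eq_add_neg]

lemma Φfun_eq (τ η : ℂ) (t : ℝ) (N : ℕ) (u w : ℂ) :
    Φfun τ η t N u w = (Complex.exp (-cπ*I*N*τ/2) * Complex.exp (-cπ*I*N*τ/2) *
      Complex.exp (cπ*I*(N+2)*τ/2)) * dI t (fun x y => Rf τ η N u w (x+y*I) (x-y*I)) := by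
  rw [← dI_mul]
  unfold Φfun dI
  simp only [conj_z, Kk_eq, Mw_eq, Rf]
  congr 1; funext y; congr 1; funext x
  ring

lemma vt_conj (t : ℝ) (z : ℂ) :
    (starRingEnd ℂ) (vt (t*I) z) = vt (t*I) ((starRingEnd ℂ) z) := by
  unfold vt
  rw [jacobiTheta₂_conj]
  congr 1; simp

lemma Gp_conj (t η : ℝ) (N : ℕ) (z : ℂ) :
    (starRingEnd ℂ) (Gp (t*I) η N z) = Gp (t*I) η N ((starRingEnd ℂ) z) := by
  unfold Gp
  rw [map_prod]
  refine Finset.prod_congr rfl fun k _ => ?_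
  rw [vt_conj]
  have e : (2*(k:ℂ)-N+1)*(η:ℂ) = (((2*(k:ℝ)-N+1)*η : ℝ):ℂ) := by push_cast; ring
  rw [e, map_add, Complex.conj_ofReal]

lemma Kk_conj (t η : ℝ) (N : ℕ) (u z : ℂ) :
    (starRingEnd ℂ) (Kk (t*I) η N z ((starRingEnd ℂ) u)) = Kk (t*I) η N u ((starRingEnd ℂ) z) := by
  rw [Kk_eq, Kk_eq, map_mul, map_mul, Gp_conj, Gp_conj, ← Complex.exp_conj]
  have e : -cπ*I*N*((t:ℂ)*I)/2 = ((Real.pi*N*t/2 : ℝ):ℂ) := by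
    unfold cπ; push_cast
    linear_combination (-(Real.pi:ℂ)*N*t/2) * Complex.I_mul_I
  rw [e, Complex.conj_ofReal, map_add, map_sub, Complex.conj_conj, add_comm u, ← Gp_neg _ _ _ (u-_)]
  congr 3; ring


/-- Φ(u, conj v) = ⟨K_v, K_u⟩, and Φ satisfies the difference equation
θ(u−w−Nη+1/2+τ/2)·Φ(u,w−η) = e^{2πiNη}·θ(u−w+Nη+1/2+τ/2)·Φ(u−η,w). -/
theorem phi_kernel_difference_equation
    (t : ℝ) (ht : 0 < t) (τ : ℂ) (hτ : τ = t * I)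
    (N : ℕ) (η : ℝ) (hη : |η| < 1 / (2 * (N + 1))) (hη0 : η ≠ 0) :
    (∀ u v : ℂ, Φfun τ (η : ℂ) t N u ((starRingEnd ℂ) v) =
      pairing τ (η : ℂ) t N (fun z => Kk τ (η : ℂ) N z ((starRingEnd ℂ) v))
        (fun z => Kk τ (η : ℂ) N z ((starRingEnd ℂ) u))) ∧
    (∀ u w : ℂ,
      θf τ (u - w - N*(η:ℂ) + 1/2 + τ/2) * Φfun τ (η : ℂ) t N u (w - η) =
      Complex.exp (2*cπ*I*N*(η:ℂ)) * θf τ (u - w + N*(η:ℂ) + 1/2 + τ/2) *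
        Φfun τ (η : ℂ) t N (u - η) w) := by
  subst hτ
  refine ⟨fun u v => ?_, fun u w => ?_⟩
  · unfold Φfun pairing
    simp only [Kk_conj]
  · have h := Rf_rel ht η N hη u w
    rw [θf_hat, θf_hat, Φfun_eq, Φfun_eq]
    have e : Complex.exp (-cπ*I*((t:ℂ)*I/4+(u-w-N*(η:ℂ)))) =
        Complex.exp (2*cπ*I*N*(η:ℂ)) * Complex.exp (-cπ*I*((t:ℂ)*I/4+(u-w+N*(η:ℂ)))) := by
      rw [← Complex.exp_add]; congr 1; ring
    rw [e]
    linear_combination (Complex.exp (2*cπ*I*N*(η:ℂ)) *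
      Complex.exp (-cπ*I*((t:ℂ)*I/4+(u-w+N*(η:ℂ)))) *
      (Complex.exp (-cπ*I*N*((t:ℂ)*I)/2) * Complex.exp (-cπ*I*N*((t:ℂ)*I)/2) *
      Complex.exp (cπ*I*(N+2)*((t:ℂ)*I)/2))) * h
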